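/- Let E₁, E₂, E_k be alphabets with E₁ ∩ E₂ ⊆ E_k ⊆ E := E₁ ∪ E₂, and let f_{1+k}, f_{2+k} be the renaming isomorphisms and P̃ the natural projection erasing the fresh (tilde) letters. A language L ⊆ E* is conditionally decomposable with respect to E₁, E₂ and E_k if and only if P̃(f_{1+k}(L) ∥ f_{2+k}(L)) = L. -/

import Mathlib

/- Language-theoretic model of discrete-event systems:
   strings over a finite alphabet (a `Finset` of symbols) are lists,
   natural projections erase letters outside the target alphabet,
   and the parallel composition is the standard synchronous composition. -/

namespace DES

variable {A : Type} [DecidableEq A]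

/-- `star E` is `E*`: the set of finite strings over the alphabet `E`. -/
def star (E : Finset A) : Set (List A) :=
  {w | ∀ a ∈ w, a ∈ E}

/-- The natural projection onto `E₀`: it keeps letters of `E₀` and erases all
other letters. -/
def proj (E₀ : Finset A) (w : List A) : List A :=
  w.filter (· ∈ E₀)

/-- The inverse image `P⁻¹(L) = { s ∈ E* : P(s) ∈ L }` of the natural projection
from `E*` onto `E₀*`. -/
def invProj (E E₀ : Finset A) (L : Set (List A)) : Set (List A) :=
  {s | s ∈ star E ∧ proj E₀ s ∈ L}

/-- Parallel composition `L₁ ∥ L₂ = P₁⁻¹(L₁) ∩ P₂⁻¹(L₂) ⊆ (E₁ ∪ E₂)*` of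
`L₁ ⊆ E₁*` and `L₂ ⊆ E₂*`. -/
def par (E₁ E₂ : Finset A) (L₁ L₂ : Set (List A)) : Set (List A) :=
  invProj (E₁ ∪ E₂) E₁ L₁ ∩ invProj (E₁ ∪ E₂) E₂ L₂

/-- Parallel composition of a finite family `L i ⊆ (E i)*`. -/
def parFam {ι : Type} [Fintype ι] (E : ι → Finset A) (L : ι → Set (List A)) :
    Set (List A) :=
  {w | w ∈ star (Finset.univ.sup E) ∧ ∀ i, proj (E i) w ∈ L i}

/-- The prefix closure of a language. -/
def pref (L : Set (List A)) : Set (List A) :=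
  {w | ∃ u, w ++ u ∈ L}

/-- `K` is conditionally decomposable w.r.t. the alphabets `E i` and `Ek`:
`K = P_{1+k}(K) ∥ ⋯ ∥ P_{n+k}(K)`. -/
def condDecomp {ι : Type} [Fintype ι] (E : ι → Finset A) (Ek : Finset A)
    (K : Set (List A)) : Prop :=
  K = parFam (fun i => E i ∪ Ek) (fun i => proj (E i ∪ Ek) '' K)

/-- Conditional decomposability for two components:
`K = P_{1+k}(K) ∥ P_{2+k}(K)`. -/
def condDecomp2 (E₁ E₂ Ek : Finset A) (K : Set (List A)) : Prop :=
  K = par (E₁ ∪ Ek) (E₂ ∪ Ek) (proj (E₁ ∪ Ek) '' K) (proj (E₂ ∪ Ek) '' K)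

/-- The natural projection from `E'*` onto `E₀*` is an `L`-observer. -/
def observer (E' E₀ : Finset A) (L : Set (List A)) : Prop :=
  ∀ t ∈ proj E₀ '' L, ∀ s ∈ pref L, proj E₀ s <+: t →
    ∃ u ∈ star E', s ++ u ∈ L ∧ proj E₀ (s ++ u) = t

/-- Letter-to-letter renaming map: letters in `Ekeep` are kept, all other
letters are renamed by `g`. -/
def ren (Ekeep : Finset A) (g : A → A) (w : List A) : List A :=
  w.map (fun a => if a ∈ Ekeep then a else g a)


theorem proj_proj (X Y : Finset A) (w : List A) :
    proj X (proj Y w) = proj (Y ∩ X) w := by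
  simp only [proj, List.filter_filter]
  congr 1
  funext a
  simp [Bool.and_comm]

theorem proj_mem_star (X : Finset A) (w : List A) : proj X w ∈ star X := by
  intro a ha
  simpa using (List.mem_filter.1 ha).2

theorem mem_star_mono {B : Type} {X Y : Finset B} (h : X ⊆ Y) {w : List B} (hw : w ∈ star X) :
    w ∈ star Y := fun a ha => h (hw a ha)

/-- Renaming letters outside `X` to letters outside `X` does not change the projection
onto `X`. -/
theorem proj_ren {E X : Finset A} {g : A → A} (hg : ∀ a ∈ E, a ∉ X → g a ∉ X)
    {w : List A} (hw : w ∈ star E) : proj X (ren X g w) = proj X w := by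
  induction w with
  | nil => rfl
  | cons a w ih =>
    have ih' := ih fun b hb => hw b (List.mem_cons_of_mem _ hb)
    have ha := hg a (hw a List.mem_cons_self)
    simp only [proj, ren, List.map_cons] at ih' ⊢
    by_cases h : a ∈ X
    · simp [h, ih']
    · simp [h, ha h, ih']

theorem ren_mem_star {E X T : Finset A} {g : A → A} (hg : ∀ a ∈ E, a ∉ X → g a ∈ T)
    {w : List A} (hw : w ∈ star E) : ren X g w ∈ star (X ∪ T) := by
  intro b hb
  obtain ⟨a, ha, rfl⟩ := List.mem_map.1 hb
  by_cases h : a ∈ X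
  · simp [h]
  · simp [h, hg a (hw a ha) h]

/-- Two words that agree on their common alphabet can be merged into a single word. -/
theorem exists_merge (X Y : Finset A) (u v : List A) (hu : u ∈ star X) (hv : v ∈ star Y)
    (h : proj Y u = proj X v) :
    ∃ w ∈ star (X ∪ Y), proj X w = u ∧ proj Y w = v := by
  match u, v with
  | [], v =>
    refine ⟨v, mem_star_mono Finset.subset_union_right hv, h.symm, ?_⟩
    exact List.filter_eq_self.2 fun a ha => by simpa using hv a ha
  | x :: u, v =>
    have hx : x ∈ X := hu x List.mem_cons_self
    have hu' : u ∈ star X := fun a ha => hu a (List.mem_cons_of_mem _ ha)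
    by_cases hxY : x ∈ Y
    · match v with
      | [] => simp [proj, hxY] at h
      | y :: v =>
        have hy : y ∈ Y := hv y List.mem_cons_self
        have hv' : v ∈ star Y := fun a ha => hv a (List.mem_cons_of_mem _ ha)
        by_cases hyX : y ∈ X
        · have h' : x = y ∧ proj Y u = proj X v := by
            simpa [proj, hxY, hyX] using h
          obtain ⟨rfl, h'⟩ := h'
          obtain ⟨w, hw, h₁, h₂⟩ := exists_merge X Y u v hu' hv' h'
          refine ⟨x :: w, ?_, ?_, ?_⟩
          · exact List.forall_mem_cons.2 ⟨Finset.mem_union_left _ hx, hw⟩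
          · simpa [proj, hx] using h₁
          · simpa [proj, hxY] using h₂
        · have h' : proj Y (x :: u) = proj X v := by
            simpa [proj, hyX] using h
          obtain ⟨w, hw, h₁, h₂⟩ := exists_merge X Y (x :: u) v hu hv' h'
          refine ⟨y :: w, ?_, ?_, ?_⟩
          · exact List.forall_mem_cons.2 ⟨Finset.mem_union_right _ hy, hw⟩
          · simpa [proj, hyX] using h₁
          · simpa [proj, hy] using h₂
    · have h' : proj Y u = proj X v := by
        simpa [proj, hxY] using h
      obtain ⟨w, hw, h₁, h₂⟩ := exists_merge X Y u v hu' hv h'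
      refine ⟨x :: w, ?_, ?_, ?_⟩
      · exact List.forall_mem_cons.2 ⟨Finset.mem_union_left _ hx, hw⟩
      · simpa [proj, hx] using h₁
      · simpa [proj, hxY] using h₂
termination_by u.length + v.length

/-- `L` is conditionally decomposable w.r.t. `E₁, E₂, E_k` iff
`P̃(f_{1+k}(L) ∥ f_{2+k}(L)) = L`. -/
theorem stmt5 {A : Type} [DecidableEq A] (E₁ E₂ Ek T₁ T₂ : Finset A)
    (hk1 : E₁ ∩ E₂ ⊆ Ek) (hk2 : Ek ⊆ E₁ ∪ E₂)
    (hT1 : Disjoint T₁ (E₁ ∪ E₂)) (hT2 : Disjoint T₂ (E₁ ∪ E₂))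
    (hT12 : Disjoint T₁ T₂)
    (g₁ g₂ : A → A)
    (hg₁ : Set.BijOn g₁ ↑(E₁ \ Ek) ↑T₁) (hg₂ : Set.BijOn g₂ ↑(E₂ \ Ek) ↑T₂)
    (L : Set (List A)) (hL : L ⊆ star (E₁ ∪ E₂)) :
    condDecomp2 E₁ E₂ Ek L ↔
      proj (E₁ ∪ E₂) ''
          par (E₁ ∪ Ek ∪ T₂) (E₂ ∪ Ek ∪ T₁)
            (ren (E₁ ∪ Ek) g₂ '' L) (ren (E₂ ∪ Ek) g₁ '' L) = L := by
  have hE₁ : ∀ a ∈ E₁ ∪ E₂, a ∉ E₁ ∪ Ek → g₂ a ∈ T₂ := fun a ha h => by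
    have : a ∈ E₂ \ Ek := by grind
    exact_mod_cast hg₂.mapsTo (by exact_mod_cast this)
  have hE₂ : ∀ a ∈ E₁ ∪ E₂, a ∉ E₂ ∪ Ek → g₁ a ∈ T₁ := fun a ha h => by
    have : a ∈ E₁ \ Ek := by grind
    exact_mod_cast hg₁.mapsTo (by exact_mod_cast this)
  rw [Finset.disjoint_left] at hT1 hT2 hT12
  have hren₁ : ∀ s ∈ L, proj (E₁ ∪ Ek) (ren (E₁ ∪ Ek) g₂ s) = proj (E₁ ∪ Ek) s :=
    fun s hs => proj_ren (fun a ha h => by grind) (hL hs)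
  have hren₂ : ∀ s ∈ L, proj (E₂ ∪ Ek) (ren (E₂ ∪ Ek) g₁ s) = proj (E₂ ∪ Ek) s :=
    fun s hs => proj_ren (fun a ha h => by grind) (hL hs)
  have hstar₁ : ∀ s ∈ L, ren (E₁ ∪ Ek) g₂ s ∈ star (E₁ ∪ Ek ∪ T₂) :=
    fun s hs => ren_mem_star hE₁ (hL hs)
  have hstar₂ : ∀ s ∈ L, ren (E₂ ∪ Ek) g₁ s ∈ star (E₂ ∪ Ek ∪ T₁) :=
    fun s hs => ren_mem_star hE₂ (hL hs)
  have hunion : E₁ ∪ Ek ∪ (E₂ ∪ Ek) = E₁ ∪ E₂ := by grind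
  have hE1k : E₁ ∪ Ek ⊆ E₁ ∪ E₂ := by grind
  have hE2k : E₂ ∪ Ek ⊆ E₁ ∪ E₂ := by grind
  have key : proj (E₁ ∪ E₂) ''
      par (E₁ ∪ Ek ∪ T₂) (E₂ ∪ Ek ∪ T₁)
        (ren (E₁ ∪ Ek) g₂ '' L) (ren (E₂ ∪ Ek) g₁ '' L) =
      par (E₁ ∪ Ek) (E₂ ∪ Ek) (proj (E₁ ∪ Ek) '' L) (proj (E₂ ∪ Ek) '' L) := by
    ext v
    constructor
    · rintro ⟨w, ⟨⟨-, s₁, hs₁, h₁⟩, -, s₂, hs₂, h₂⟩, rfl⟩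
      have hv : proj (E₁ ∪ E₂) w ∈ star (E₁ ∪ Ek ∪ (E₂ ∪ Ek)) :=
        hunion ▸ proj_mem_star _ _
      refine ⟨⟨hv, s₁, hs₁, ?_⟩, hv, s₂, hs₂, ?_⟩
      · rw [← hren₁ s₁ hs₁, h₁, proj_proj, proj_proj]
        congr 1
        grind
      · rw [← hren₂ s₂ hs₂, h₂, proj_proj, proj_proj]
        congr 1
        grind
    · rintro ⟨⟨hv, s₁, hs₁, h₁⟩, -, s₂, hs₂, h₂⟩
      rw [hunion] at hv
      have hvE : proj (E₁ ∪ E₂) v = v :=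
        List.filter_eq_self.2 fun a ha => by simpa using hv a ha
      have hfilter₁ : proj (E₁ ∪ E₂) (ren (E₁ ∪ Ek) g₂ s₁) = proj (E₁ ∪ Ek) s₁ := by
        rw [← hren₁ s₁ hs₁]
        refine List.filter_congr fun a ha => ?_
        have := hstar₁ s₁ hs₁ a ha
        rw [decide_eq_decide]
        grind
      have hfilter₂ : proj (E₁ ∪ E₂ ∪ (E₁ ∪ Ek ∪ T₂)) (ren (E₂ ∪ Ek) g₁ s₂) =
          proj (E₂ ∪ Ek) s₂ := by
        rw [← hren₂ s₂ hs₂]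
        refine List.filter_congr fun a ha => ?_
        have := hstar₂ s₂ hs₂ a ha
        rw [decide_eq_decide]
        grind
      obtain ⟨w, hw, hwE, hw₁⟩ := exists_merge (E₁ ∪ E₂) (E₁ ∪ Ek ∪ T₂) v
        (ren (E₁ ∪ Ek) g₂ s₁) hv (hstar₁ s₁ hs₁) (by
          rw [hfilter₁, h₁, ← hvE, proj_proj, proj_proj]
          congr 1
          grind)
      obtain ⟨z, hz, hzw, hz₂⟩ := exists_merge (E₁ ∪ E₂ ∪ (E₁ ∪ Ek ∪ T₂)) (E₂ ∪ Ek ∪ T₁) w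
        (ren (E₂ ∪ Ek) g₁ s₂) hw (hstar₂ s₂ hs₂) (by
          rw [hfilter₂, h₂, ← hwE, proj_proj]
          refine List.filter_congr fun a ha => ?_
          have := hw a ha
          rw [decide_eq_decide]
          grind)
      have hz' : z ∈ star (E₁ ∪ Ek ∪ T₂ ∪ (E₂ ∪ Ek ∪ T₁)) :=
        mem_star_mono (by grind) hz
      refine ⟨z, ⟨⟨hz', s₁, hs₁, ?_⟩, hz', s₂, hs₂, hz₂.symm⟩, ?_⟩
      · rw [← hw₁, ← hzw, proj_proj]
        congr 1
        grind
      · rw [← hwE, ← hzw, proj_proj]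
        congr 1
        grind
  rw [key, condDecomp2, eq_comm]

end DES
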